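/- arXiv:1708.01861 — 2 statements merged into one kernel-verified Lean document; each statement's English description precedes it below -/
import Mathlib

section
/- Fix integers m ≥ 1, n ≥ 1 and reals ν > m−1, σ² > 0, ρ² > 0. For every x^n = (x_1,…,x_n) ∈ (ℝ^m)^n, the maximized luckiness-weighted likelihood satisfies f(x^n;μ̄_n,Σ̄_n)·π(μ̄_n,Σ̄_n;ν,σ²,ρ²) = (2πe)^{−m(ν+n)/2}·|Σ̄_n|^{−(ν+n)/2}. -/
open MeasureTheory Matrix Real BigOperators

/-- Likelihood of `n` observations under the `m`-dimensional normal distribution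
with mean `μ` and covariance `S`. -/
noncomputable def mvnLik (m n : ℕ) (x : Fin n → Fin m → ℝ) (μ : Fin m → ℝ)
    (S : Matrix (Fin m) (Fin m) ℝ) : ℝ :=
  ∏ i : Fin n, (2 * π) ^ (-(m : ℝ) / 2) * S.det ^ (-(1 : ℝ) / 2) *
    Real.exp (-(1 / 2) * ((x i - μ) ⬝ᵥ (S⁻¹ *ᵥ (x i - μ))))

/-- The simple luckiness function `π(μ, Σ; ν, σ², ρ²)`. -/
noncomputable def luck (m : ℕ) (μ : Fin m → ℝ) (S : Matrix (Fin m) (Fin m) ℝ)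
    (ν σ2 ρ2 : ℝ) : ℝ :=
  (2 * π) ^ (-(m : ℝ) * ν / 2) * S.det ^ (-ν / 2) *
    Real.exp (-(ν / 2) *
      (S⁻¹ * (σ2 • (1 : Matrix (Fin m) (Fin m) ℝ) + ρ2 • vecMulVec μ μ)).trace)

/-- The generalized luckiness function `π(μ, Σ; ν, μ₀, Σ₀, ρ²)`. -/
noncomputable def luck2 (m : ℕ) (μ : Fin m → ℝ) (S : Matrix (Fin m) (Fin m) ℝ)
    (ν : ℝ) (μ0 : Fin m → ℝ) (S0 : Matrix (Fin m) (Fin m) ℝ) (ρ2 : ℝ) : ℝ :=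
  (2 * π) ^ (-(m : ℝ) * ν / 2) * S.det ^ (-ν / 2) *
    Real.exp (-(ν / 2) *
      (S⁻¹ * (S0 + ρ2 • vecMulVec (μ - μ0) (μ - μ0))).trace)

/-- MAP location estimate `μ̄_k` for the simple luckiness. -/
noncomputable def muBar (m k : ℕ) (ν ρ2 : ℝ) (x : Fin k → Fin m → ℝ) : Fin m → ℝ :=
  (1 / (k + ρ2 * ν)) • ∑ i : Fin k, x i

/-- MAP covariance estimate `Σ̄_k` for the simple luckiness. -/
noncomputable def sigmaBar (m k : ℕ) (ν σ2 ρ2 : ℝ) (x : Fin k → Fin m → ℝ) :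
    Matrix (Fin m) (Fin m) ℝ :=
  (1 / (k + ν)) •
      (∑ i : Fin k, vecMulVec (x i) (x i) + (ν * σ2) • (1 : Matrix (Fin m) (Fin m) ℝ))
    - (1 / ((ν + k) * (ρ2 * ν + k))) • ∑ i : Fin k, ∑ j : Fin k, vecMulVec (x i) (x j)

/-- MAP location estimate `μ̄_k` for the generalized luckiness. -/
noncomputable def muBar2 (m k : ℕ) (ν ρ2 : ℝ) (μ0 : Fin m → ℝ)
    (x : Fin k → Fin m → ℝ) : Fin m → ℝ :=
  μ0 + (1 / (k + ρ2 * ν)) • ∑ i : Fin k, (x i - μ0)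

/-- MAP covariance estimate `Σ̄_k` for the generalized luckiness. -/
noncomputable def sigmaBar2 (m k : ℕ) (ν ρ2 : ℝ) (μ0 : Fin m → ℝ)
    (S0 : Matrix (Fin m) (Fin m) ℝ) (x : Fin k → Fin m → ℝ) : Matrix (Fin m) (Fin m) ℝ :=
  (1 / (k + ν)) • (∑ i : Fin k, vecMulVec (x i - μ0) (x i - μ0) + ν • S0)
    - (1 / ((ν + k) * (ρ2 * ν + k))) •
        ∑ i : Fin k, ∑ j : Fin k, vecMulVec (x i - μ0) (x j - μ0)

/-- The multivariate gamma function `Γ_m(z)`. -/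
noncomputable def multiGamma (m : ℕ) (z : ℝ) : ℝ :=
  π ^ ((m : ℝ) * ((m : ℝ) - 1) / 4) * ∏ j : Fin m, Real.Gamma (z - (j : ℝ) / 2)

/-- The capacity `𝒞(m, n, ν, σ², ρ²)` (note: the fourth argument is `σ²`,
so `σ^{-mν} = (σ²)^{-mν/2}`). -/
noncomputable def capC (m n : ℕ) (ν σ2 ρ2 : ℝ) : ℝ :=
  σ2 ^ (-(m : ℝ) * ν / 2) *
    ((((n : ℝ) + ν) ^ ((n : ℝ) + ν) * (1 + n / (ρ2 * ν))) /
        ((2 * Real.exp 1) ^ ((n : ℝ) + ν) * (π * ν) ^ ν)) ^ ((m : ℝ) / 2) *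
    (multiGamma m (ν / 2) / multiGamma m (((n : ℝ) + ν) / 2))

/-- The pointwise supremum of likelihood times simple luckiness over all `μ`
and positive definite `Σ`. -/
noncomputable def supLik (m n : ℕ) (ν σ2 ρ2 : ℝ) (x : Fin n → Fin m → ℝ) : ℝ :=
  ⨆ p : (Fin m → ℝ) × {S : Matrix (Fin m) (Fin m) ℝ // S.PosDef},
    mvnLik m n x p.1 p.2.1 * luck m p.1 p.2.1 ν σ2 ρ2

/-- The pointwise supremum of likelihood times generalized luckiness over all `μ`
and positive definite `Σ`. -/
noncomputable def supLik2 (m n : ℕ) (ν : ℝ) (μ0 : Fin m → ℝ)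
    (S0 : Matrix (Fin m) (Fin m) ℝ) (ρ2 : ℝ) (x : Fin n → Fin m → ℝ) : ℝ :=
  ⨆ p : (Fin m → ℝ) × {S : Matrix (Fin m) (Fin m) ℝ // S.PosDef},
    mvnLik m n x p.1 p.2.1 * luck2 m p.1 p.2.1 ν μ0 S0 ρ2

/-- The density of the `m`-variate Student t-distribution with `d` degrees of
freedom, location `μ` and scale matrix `S`. -/
noncomputable def tDens (m : ℕ) (d : ℝ) (x μ : Fin m → ℝ)
    (S : Matrix (Fin m) (Fin m) ℝ) : ℝ :=
  Real.Gamma ((d + m) / 2) /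
      (Real.Gamma (d / 2) * (d * π) ^ ((m : ℝ) / 2) * S.det ^ ((1 : ℝ) / 2)) *
    (1 + (1 / d) * ((x - μ) ⬝ᵥ (S⁻¹ *ᵥ (x - μ)))) ^ (-(d + (m : ℝ)) / 2)

/-- The likelihood depends on the data only through the scatter matrix about `μ`. -/
theorem mvnLik_eq_exp_trace (m n : ℕ) (x : Fin n → Fin m → ℝ) (μ : Fin m → ℝ)
    {S : Matrix (Fin m) (Fin m) ℝ} (hS : 0 ≤ S.det) :
    mvnLik m n x μ S = (2 * π) ^ (-(m : ℝ) * n / 2) * S.det ^ (-(n : ℝ) / 2) *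
      Real.exp (-(1 / 2) * (S⁻¹ * ∑ i, vecMulVec (x i - μ) (x i - μ)).trace) := by
  have htr : (S⁻¹ * ∑ i, vecMulVec (x i - μ) (x i - μ)).trace =
      ∑ i, (x i - μ) ⬝ᵥ (S⁻¹ *ᵥ (x i - μ)) := by
    simp only [Matrix.mul_sum, trace_sum, mul_vecMulVec, trace_vecMulVec]
    exact Finset.sum_congr rfl fun i _ => dotProduct_comm _ _
  rw [htr, Finset.mul_sum, Real.exp_sum, mvnLik, Finset.prod_mul_distrib, Finset.prod_const,
    Finset.card_univ, Fintype.card_fin, mul_pow, ← Real.rpow_mul_natCast (by positivity),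
    ← Real.rpow_mul_natCast hS, div_mul_eq_mul_div, div_mul_eq_mul_div, neg_one_mul]

/-- The scatter matrix about the MAP location, together with the contribution of the luckiness
function, is a multiple of the MAP covariance. -/
theorem scatter_muBar_add (m n : ℕ) {ν σ2 ρ2 : ℝ} (hν : 0 < ν) (hρ : 0 < ρ2)
    (x : Fin n → Fin m → ℝ) :
    ∑ i, vecMulVec (x i - muBar m n ν ρ2 x) (x i - muBar m n ν ρ2 x) +
        ν • (σ2 • (1 : Matrix (Fin m) (Fin m) ℝ) +
          ρ2 • vecMulVec (muBar m n ν ρ2 x) (muBar m n ν ρ2 x)) =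
      (ν + n) • sigmaBar m n ν σ2 ρ2 x := by
  have hc : (n : ℝ) + ρ2 * ν ≠ 0 := by positivity
  have hc' : ρ2 * ν + (n : ℝ) ≠ 0 := by positivity
  have hd : (n : ℝ) + ν ≠ 0 := by positivity
  have hd' : ν + (n : ℝ) ≠ 0 := by positivity
  ext a b
  simp only [sigmaBar, muBar, Matrix.add_apply, Matrix.sub_apply, Matrix.smul_apply,
    Matrix.sum_apply, vecMulVec_apply, Pi.sub_apply, Pi.smul_apply, Finset.sum_apply, smul_eq_mul,
    sub_mul, mul_sub, Finset.sum_sub_distrib, ← Finset.sum_mul, ← Finset.mul_sum,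
    Finset.sum_const, Finset.card_univ, Fintype.card_fin, nsmul_eq_mul]
  field_simp
  ring

/-- The MAP covariance estimate is positive definite. -/
theorem sigmaBar_posDef (m n : ℕ) {ν σ2 ρ2 : ℝ} (hν : 0 < ν) (hσ : 0 < σ2) (hρ : 0 < ρ2)
    (x : Fin n → Fin m → ℝ) : (sigmaBar m n ν σ2 ρ2 x).PosDef := by
  have hd : 0 < ν + (n : ℝ) := by positivity
  have hvec (v : Fin m → ℝ) : (vecMulVec v v).PosSemidef := by
    simpa using posSemidef_vecMulVec_self_star v
  have hpos : ((ν + n) • sigmaBar m n ν σ2 ρ2 x).PosDef := by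
    rw [← scatter_muBar_add m n hν hρ x]
    exact Matrix.PosDef.posSemidef_add (posSemidef_sum _ fun i _ => hvec _)
      (((Matrix.PosDef.one.smul hσ).add_posSemidef ((hvec _).smul hρ.le)).smul hν)
  simpa [smul_smul, inv_mul_cancel₀ hd.ne'] using hpos.smul (inv_pos.mpr hd)

/-- the maximized luckiness-weighted likelihood equals
`(2πe)^{-m(ν+n)/2} |Σ̄_n|^{-(ν+n)/2}`. -/
theorem lnml_max_value (m n : ℕ) (hm : 1 ≤ m) (hn : 1 ≤ n) (ν σ2 ρ2 : ℝ)
    (hν : (m : ℝ) - 1 < ν) (hσ : 0 < σ2) (hρ : 0 < ρ2)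
    (x : Fin n → Fin m → ℝ) :
    mvnLik m n x (muBar m n ν ρ2 x) (sigmaBar m n ν σ2 ρ2 x) *
        luck m (muBar m n ν ρ2 x) (sigmaBar m n ν σ2 ρ2 x) ν σ2 ρ2 =
      (2 * π * Real.exp 1) ^ (-(m : ℝ) * (ν + n) / 2) *
        (sigmaBar m n ν σ2 ρ2 x).det ^ (-(ν + n) / 2) := by
  have hν0 : 0 < ν := by
    have : (1 : ℝ) ≤ m := by exact_mod_cast hm
    linarith
  have hdet := (sigmaBar_posDef m n hν0 hσ hρ x).det_pos
  have hscatter := scatter_muBar_add m n (σ2 := σ2) hν0 hρ x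
  rw [mvnLik_eq_exp_trace m n x _ hdet.le, luck]
  generalize sigmaBar m n ν σ2 ρ2 x = S at *
  generalize muBar m n ν ρ2 x = μ at *
  have htr : (S⁻¹ * ∑ i, vecMulVec (x i - μ) (x i - μ)).trace +
      ν * (S⁻¹ * (σ2 • (1 : Matrix (Fin m) (Fin m) ℝ) + ρ2 • vecMulVec μ μ)).trace =
        (ν + n) * m := by
    simpa [mul_add, nonsing_inv_mul S hdet.ne'.isUnit] using
      congrArg (fun M => (S⁻¹ * M).trace) hscatter
  have hexp : Real.exp 1 ^ (-(m : ℝ) * (ν + n) / 2) =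
      Real.exp (-(1 / 2) * (S⁻¹ * ∑ i, vecMulVec (x i - μ) (x i - μ)).trace) *
        Real.exp (-(ν / 2) *
          (S⁻¹ * (σ2 • (1 : Matrix (Fin m) (Fin m) ℝ) + ρ2 • vecMulVec μ μ)).trace) := by
    rw [Real.exp_one_rpow, ← Real.exp_add]
    congr 1
    linear_combination (1 / 2) * htr
  rw [Real.mul_rpow (x := 2 * π) (y := Real.exp 1) (by positivity) (by positivity), hexp,
    show -(m : ℝ) * (ν + n) / 2 = -(m : ℝ) * n / 2 + -(m : ℝ) * ν / 2 by ring,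
    show -(ν + n) / 2 = -(n : ℝ) / 2 + -ν / 2 by ring,
    Real.rpow_add (by positivity), Real.rpow_add hdet]
  ring
end

section
/- (Theorem 1, capacity.) Fix integers m ≥ 1, n ≥ 1 and reals ν > m−1, σ² > 0, ρ² > 0. Then ∫_{(ℝ^m)^n} sup_{μ∈ℝ^m, Σ≻0} f(x^n;μ,Σ)·π(μ,Σ;ν,σ²,ρ²) dx^n = 𝒞(m,n,ν,σ²,ρ²), where 𝒞(m,n,ν,σ²,ρ²) = σ^{−mν}·((n+ν)^{n+ν}·(1+n/(ρ²ν)) / ((2e)^{n+ν}·(πν)^ν))^{m/2} · Γ_m(ν/2)/Γ_m((n+ν)/2). -/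
open MeasureTheory Matrix Real BigOperators

open scoped ENNReal MatrixOrder

lemma lintegral_exp_neg_mul_dotProduct_self (m : ℕ) {t : ℝ} (ht : 0 < t) :
    ∫⁻ z : Fin m → ℝ, ENNReal.ofReal (exp (-t * (z ⬝ᵥ z))) =
      ENNReal.ofReal ((π / t) ^ ((m : ℝ) / 2)) := by
  have h1 : ∀ z : Fin m → ℝ, exp (-t * (z ⬝ᵥ z)) = ∏ i, exp (-t * z i ^ 2) := by
    intro z
    rw [← exp_sum, ← Finset.mul_sum, dotProduct]
    simp_rw [sq]
  have hint : ∫ z : Fin m → ℝ, exp (-t * (z ⬝ᵥ z)) = (π / t) ^ ((m : ℝ) / 2) := by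
    simp_rw [h1]
    rw [integral_fintype_prod_volume_eq_pow (fun x : ℝ => exp (-t * x ^ 2)), integral_gaussian,
      Fintype.card_fin, sqrt_eq_rpow, ← rpow_natCast, ← rpow_mul (by positivity)]
    congr 1
    ring
  rw [← hint, ofReal_integral_eq_lintegral_ofReal]
  · refine Integrable.of_integral_ne_zero ?_
    rw [hint]
    positivity
  · exact ae_of_all _ fun z => (exp_pos _).le

lemma lintegral_rpow_mul_exp_neg_mul_Ioi {a r : ℝ} (ha : 0 < a) (hr : 0 < r) :
    ∫⁻ t in Set.Ioi (0 : ℝ), ENNReal.ofReal (t ^ (a - 1) * exp (-(r * t))) =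
      ENNReal.ofReal (r ^ (-a) * Gamma a) := by
  have h : r ^ (-a) * Gamma a = ∫ t in Set.Ioi (0 : ℝ), t ^ (a - 1) * exp (-(r * t)) := by
    rw [integral_rpow_mul_exp_neg_mul_Ioi ha hr, one_div, inv_rpow hr.le, rpow_neg hr.le]
  rw [h, ofReal_integral_eq_lintegral_ofReal]
  · refine Integrable.of_integral_ne_zero ?_
    rw [← h]
    exact (mul_pos (rpow_pos_of_pos hr _) (Gamma_pos_of_pos ha)).ne'
  · filter_upwards [ae_restrict_mem measurableSet_Ioi] with t (ht : 0 < t)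
    exact (mul_pos (rpow_pos_of_pos ht _) (exp_pos _)).le

/-- The total mass of the unnormalized `m`-variate Student density `(1 + ‖z‖²) ^ (-p / 2)`. -/
noncomputable def studentMass (m : ℕ) (p : ℝ) : ℝ :=
  π ^ ((m : ℝ) / 2) * Gamma ((p - m) / 2) / Gamma (p / 2)

lemma studentMass_pos {m : ℕ} {p : ℝ} (hp : (m : ℝ) < p) : 0 < studentMass m p := by
  have h1 : 0 < Gamma ((p - m) / 2) := Gamma_pos_of_pos (by linarith)
  have h2 : 0 < Gamma (p / 2) :=
    Gamma_pos_of_pos (by linarith [(Nat.cast_nonneg m : (0 : ℝ) ≤ m)])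
  unfold studentMass
  positivity

lemma lintegral_one_add_dotProduct_self_rpow (m : ℕ) {p : ℝ} (hp : (m : ℝ) < p) :
    ∫⁻ z : Fin m → ℝ, ENNReal.ofReal ((1 + z ⬝ᵥ z) ^ (-p / 2)) =
      ENNReal.ofReal (studentMass m p) := by
  have hp0 : 0 < p / 2 := by linarith [(Nat.cast_nonneg m : (0 : ℝ) ≤ m)]
  have hG : 0 < Gamma (p / 2) := Gamma_pos_of_pos hp0
  have hq : ∀ z : Fin m → ℝ, 0 < 1 + z ⬝ᵥ z := fun z => by
    have : 0 ≤ z ⬝ᵥ z := Finset.sum_nonneg fun i _ => mul_self_nonneg _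
    linarith
  have hG' : ENNReal.ofReal (Gamma (p / 2)) ≠ 0 := by simpa using hG
  rw [← ENNReal.mul_right_inj hG' ENNReal.ofReal_ne_top, ← lintegral_const_mul' _ _
    ENNReal.ofReal_ne_top]
  have h1 : ∀ z : Fin m → ℝ, ENNReal.ofReal (Gamma (p / 2)) *
      ENNReal.ofReal ((1 + z ⬝ᵥ z) ^ (-p / 2)) =
      ∫⁻ t in Set.Ioi (0 : ℝ),
        ENNReal.ofReal (t ^ (p / 2 - 1) * exp (-((1 + z ⬝ᵥ z) * t))) := by
    intro z
    rw [lintegral_rpow_mul_exp_neg_mul_Ioi hp0 (hq z), ← ENNReal.ofReal_mul hG.le, mul_comm,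
      neg_div]
  simp_rw [h1]
  rw [lintegral_lintegral_swap (by unfold dotProduct Function.uncurry; fun_prop)]
  have h2 : ∀ t ∈ Set.Ioi (0 : ℝ), ∫⁻ z : Fin m → ℝ,
      ENNReal.ofReal (t ^ (p / 2 - 1) * exp (-((1 + z ⬝ᵥ z) * t))) =
      ENNReal.ofReal (π ^ ((m : ℝ) / 2)) *
        ENNReal.ofReal (t ^ ((p - m) / 2 - 1) * exp (-(1 * t))) := by
    intro t (ht : 0 < t)
    have h3 : ∀ z : Fin m → ℝ, ENNReal.ofReal (t ^ (p / 2 - 1) * exp (-((1 + z ⬝ᵥ z) * t))) =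
        ENNReal.ofReal (t ^ (p / 2 - 1) * exp (-t)) * ENNReal.ofReal (exp (-t * (z ⬝ᵥ z))) := by
      intro z
      rw [← ENNReal.ofReal_mul (by positivity), mul_assoc, ← exp_add]
      ring_nf
    simp_rw [h3]
    rw [lintegral_const_mul' _ _ ENNReal.ofReal_ne_top,
      lintegral_exp_neg_mul_dotProduct_self m ht, ← ENNReal.ofReal_mul (by positivity),
      ← ENNReal.ofReal_mul (by positivity), div_rpow pi_pos.le ht.le,
      show (p - m) / 2 - 1 = (p / 2 - 1) - m / 2 by ring, rpow_sub ht (p / 2 - 1), one_mul]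
    congr 1
    ring
  rw [setLIntegral_congr_fun measurableSet_Ioi h2, lintegral_const_mul' _ _ ENNReal.ofReal_ne_top,
    lintegral_rpow_mul_exp_neg_mul_Ioi (by linarith) one_pos, ← ENNReal.ofReal_mul (by positivity),
    ← ENNReal.ofReal_mul hG.le, one_rpow, studentMass]
  congr 1
  field_simp

lemma lintegral_comp_mulVec {m : ℕ} {M : Matrix (Fin m) (Fin m) ℝ} (hM : M.det ≠ 0)
    (g : (Fin m → ℝ) → ℝ≥0∞) (hg : Measurable g) :
    ∫⁻ y, g y = ENNReal.ofReal |M.det| * ∫⁻ z, g (M *ᵥ z) := by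
  have h := Real.map_matrix_volume_pi_eq_smul_volume_pi hM
  have hmeas : Measurable (toLin' M) := (toLin' M).continuous_of_finiteDimensional.measurable
  have h2 : ∫⁻ z, g (M *ᵥ z) = ENNReal.ofReal |M.det⁻¹| * ∫⁻ y, g y := by
    rw [← smul_eq_mul, ← lintegral_smul_measure, ← h, lintegral_map hg hmeas]
    simp [toLin'_apply]
  rw [h2, ← mul_assoc, ← ENNReal.ofReal_mul (abs_nonneg _), ← abs_mul, mul_inv_cancel₀ hM]
  simp

lemma det_one_add_vecMulVec_self {m : ℕ} (z : Fin m → ℝ) :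
    (1 + vecMulVec z z).det = 1 + z ⬝ᵥ z := by
  rw [vecMulVec_eq Unit, det_one_add_replicateCol_mul_replicateRow]

lemma Matrix.PosDef.exists_transpose_mul_self {m : ℕ} {B : Matrix (Fin m) (Fin m) ℝ}
    (hB : B.PosDef) : ∃ C : Matrix (Fin m) (Fin m) ℝ, B = Cᵀ * C := by
  obtain ⟨C, hC⟩ := CStarAlgebra.nonneg_iff_eq_star_mul_self.mp hB.posSemidef.nonneg
  exact ⟨C, by simpa [star_eq_conjTranspose] using hC⟩

lemma lintegral_det_add_smul_vecMulVec {m : ℕ} {B : Matrix (Fin m) (Fin m) ℝ} (hB : B.PosDef)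
    {p k : ℝ} (hp : (m : ℝ) < p) (hk : 0 < k) (v : Fin m → ℝ) :
    ∫⁻ y, ENNReal.ofReal ((B + k • vecMulVec (y - v) (y - v)).det ^ (-p / 2)) =
      ENNReal.ofReal (k ^ (-(m : ℝ) / 2) * B.det ^ (-(p - 1) / 2) * studentMass m p) := by
  obtain ⟨C, rfl⟩ := hB.exists_transpose_mul_self
  have hdet : (Cᵀ * C).det = C.det ^ 2 := by rw [det_mul, det_transpose, sq]
  have hC : C.det ≠ 0 := fun h => hB.det_pos.ne' (by rw [hdet, h]; simp)
  have hsk : 0 < √k := sqrt_pos.mpr hk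
  have hM : ((√k)⁻¹ • Cᵀ).det = (√k)⁻¹ ^ m * C.det := by
    rw [det_smul, Fintype.card_fin, det_transpose]
  rw [lintegral_sub_right_eq_self
      (fun y => ENNReal.ofReal ((Cᵀ * C + k • vecMulVec y y).det ^ (-p / 2))) v,
    lintegral_comp_mulVec (M := (√k)⁻¹ • Cᵀ) (by rw [hM]; positivity)
      _ ((Continuous.matrix_det (by fun_prop)).measurable.pow_const _).ennreal_ofReal]
  have key : ∀ z : Fin m → ℝ, Cᵀ * C +
      k • vecMulVec (((√k)⁻¹ • Cᵀ) *ᵥ z) (((√k)⁻¹ • Cᵀ) *ᵥ z) = Cᵀ * (1 + vecMulVec z z) * C := by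
    intro z
    have hk' : k * ((√k)⁻¹ * (√k)⁻¹) = 1 := by
      rw [← mul_inv, mul_self_sqrt hk.le, mul_inv_cancel₀ hk.ne']
    rw [smul_mulVec, smul_vecMulVec, vecMulVec_smul, smul_smul, smul_smul, mul_assoc, hk',
      one_smul, mul_add, add_mul, mul_one, mul_vecMulVec, vecMulVec_mul, mulVec_transpose]
  have hz : ∀ z : Fin m → ℝ, 0 ≤ 1 + z ⬝ᵥ z := fun z => by
    have : 0 ≤ z ⬝ᵥ z := Finset.sum_nonneg fun i _ => mul_self_nonneg _
    linarith
  have key2 : ∀ z : Fin m → ℝ, ENNReal.ofReal ((Cᵀ * (1 + vecMulVec z z) * C).det ^ (-p / 2)) =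
      ENNReal.ofReal ((Cᵀ * C).det ^ (-p / 2)) * ENNReal.ofReal ((1 + z ⬝ᵥ z) ^ (-p / 2)) := by
    intro z
    rw [← ENNReal.ofReal_mul (rpow_nonneg hB.det_pos.le _), ← mul_rpow hB.det_pos.le (hz z),
      det_mul, det_mul, det_one_add_vecMulVec_self, det_mul]
    ring_nf
  simp_rw [key, key2]
  rw [lintegral_const_mul' _ _ ENNReal.ofReal_ne_top,
    lintegral_one_add_dotProduct_self_rpow m hp,
    ← ENNReal.ofReal_mul (rpow_nonneg hB.det_pos.le _), ← ENNReal.ofReal_mul (abs_nonneg _)]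
  congr 1
  have h1 : |C.det| = (Cᵀ * C).det ^ ((1 : ℝ) / 2) := by
    rw [hdet, ← sqrt_eq_rpow, sqrt_sq_eq_abs]
  have h2 : (√k)⁻¹ ^ m = k ^ (-(m : ℝ) / 2) := by
    rw [sqrt_eq_rpow, ← rpow_neg hk.le, ← rpow_natCast, ← rpow_mul hk.le]
    congr 1
    ring
  rw [hM, abs_mul, h1, h2, abs_of_pos (by positivity),
    show -(p - 1) / 2 = 1 / 2 + -p / 2 by ring, rpow_add hB.det_pos]
  ring

/-- The scatter matrix `B + ∑ xᵢ xᵢᵀ - c s sᵀ` with `s = ∑ xᵢ`. -/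
noncomputable def scatter {m n : ℕ} (c : ℝ) (B : Matrix (Fin m) (Fin m) ℝ)
    (x : Fin n → Fin m → ℝ) : Matrix (Fin m) (Fin m) ℝ :=
  B + ∑ i, vecMulVec (x i) (x i) - c • vecMulVec (∑ i, x i) (∑ i, x i)

lemma continuous_scatter {m n : ℕ} (c : ℝ) (B : Matrix (Fin m) (Fin m) ℝ) :
    Continuous (scatter (n := n) c B) := by
  unfold scatter
  fun_prop

lemma dotProduct_vecMulVec_self_mulVec {m : ℕ} (u v : Fin m → ℝ) :
    u ⬝ᵥ (vecMulVec v v *ᵥ u) = (v ⬝ᵥ u) ^ 2 := by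
  rw [vecMulVec_mulVec]
  simp [dotProduct_comm u v, sq]

lemma scatter_posDef {m n : ℕ} {c : ℝ} (hc : 0 ≤ c) (hcn : c * n ≤ 1)
    {B : Matrix (Fin m) (Fin m) ℝ} (hB : B.PosDef) (x : Fin n → Fin m → ℝ) :
    (scatter c B x).PosDef := by
  rw [scatter, add_sub_assoc]
  refine hB.add_posSemidef (PosSemidef.of_dotProduct_mulVec_nonneg ?_ fun u => ?_)
  · ext i j
    simp [vecMulVec_apply, Matrix.sum_apply, mul_comm]
  · rw [star_trivial, sub_mulVec, smul_mulVec, sum_mulVec, dotProduct_sub, dotProduct_sum,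
      dotProduct_smul, dotProduct_vecMulVec_self_mulVec, sum_dotProduct]
    simp_rw [dotProduct_vecMulVec_self_mulVec]
    have h := sq_sum_le_card_mul_sum_sq (s := Finset.univ) (f := fun i => x i ⬝ᵥ u)
    rw [Finset.card_univ, Fintype.card_fin] at h
    have hS : 0 ≤ ∑ i, (x i ⬝ᵥ u) ^ 2 := Finset.sum_nonneg fun i _ => sq_nonneg _
    rw [smul_eq_mul, sub_nonneg]
    calc c * (∑ i, x i ⬝ᵥ u) ^ 2 ≤ c * (n * ∑ i, (x i ⬝ᵥ u) ^ 2) := by gcongr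
      _ = (c * n) * ∑ i, (x i ⬝ᵥ u) ^ 2 := by ring
      _ ≤ 1 * ∑ i, (x i ⬝ᵥ u) ^ 2 := by gcongr
      _ = _ := one_mul _

lemma scatter_cons {m n : ℕ} {c : ℝ} (hc : c < 1) (B : Matrix (Fin m) (Fin m) ℝ)
    (y : Fin m → ℝ) (x : Fin n → Fin m → ℝ) :
    scatter c B (Fin.cons y x : Fin (n + 1) → Fin m → ℝ) =
      scatter (c / (1 - c)) B x + (1 - c) •
        vecMulVec (y - (c / (1 - c)) • ∑ i, x i) (y - (c / (1 - c)) • ∑ i, x i) := by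
  have h : 1 - c ≠ 0 := by linarith
  simp only [scatter, Fin.sum_univ_succ, Fin.cons_zero, Fin.cons_succ]
  generalize ∑ i, x i = s
  ext i j
  simp only [Matrix.add_apply, Matrix.sub_apply, Matrix.smul_apply, vecMulVec_apply, Pi.add_apply, Pi.sub_apply,
    Pi.smul_apply, smul_eq_mul]
  field_simp
  ring

lemma lintegral_fin_succ {m n : ℕ} {g : (Fin (n + 1) → Fin m → ℝ) → ℝ≥0∞} (hg : Measurable g) :
    ∫⁻ x, g x = ∫⁻ x : Fin n → Fin m → ℝ, ∫⁻ y : Fin m → ℝ, g (Fin.cons y x) := by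
  have h := (volume_preserving_piFinSuccAbove (fun _ : Fin (n + 1) => Fin m → ℝ) 0).symm
  rw [← h.lintegral_comp hg, Measure.volume_eq_prod]
  refine (lintegral_prod_symm _ (hg.comp h.measurable).aemeasurable).trans ?_
  simp [MeasurableEquiv.piFinSuccAbove, Fin.insertNthEquiv]

lemma lintegral_det_scatter {m n : ℕ} {c ν : ℝ} (hc : 0 ≤ c) (hcn : c * n < 1)
    (hν : (m : ℝ) - 1 < ν) {B : Matrix (Fin m) (Fin m) ℝ} (hB : B.PosDef) :
    ∫⁻ x : Fin n → Fin m → ℝ, ENNReal.ofReal ((scatter c B x).det ^ (-(n + ν) / 2)) =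
      ENNReal.ofReal ((1 - c * n) ^ (-(m : ℝ) / 2) * B.det ^ (-ν / 2) *
        ∏ k ∈ Finset.range n, studentMass m (k + 1 + ν)) := by
  induction n generalizing c with
  | zero => simp [lintegral_unique, scatter, volume_pi]
  | succ n ih =>
    push_cast at hcn ⊢
    have hn : (0 : ℝ) ≤ n := n.cast_nonneg
    have hcn' : 0 ≤ c * n := by positivity
    have hc1 : c < 1 := by linarith
    have h1c : 0 < 1 - c := by linarith
    have hm : (m : ℝ) < n + 1 + ν := by linarith
    have hd : c / (1 - c) * n < 1 := by
      rw [div_mul_eq_mul_div, div_lt_one h1c]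
      linarith
    have hprod : 1 - c * (n + 1) = (1 - c) * (1 - c / (1 - c) * n) := by
      field_simp
      ring
    rw [lintegral_fin_succ
      ((continuous_scatter c B).matrix_det.measurable.pow_const _).ennreal_ofReal]
    have inner : ∀ x : Fin n → Fin m → ℝ, ∫⁻ y : Fin m → ℝ,
        ENNReal.ofReal ((scatter c B (Fin.cons y x : Fin (n + 1) → Fin m → ℝ)).det ^
          (-(n + 1 + ν) / 2)) =
        ENNReal.ofReal ((1 - c) ^ (-(m : ℝ) / 2) * studentMass m (n + 1 + ν)) *
          ENNReal.ofReal ((scatter (c / (1 - c)) B x).det ^ (-(n + ν) / 2)) := by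
      intro x
      simp_rw [scatter_cons hc1]
      rw [lintegral_det_add_smul_vecMulVec (scatter_posDef (by positivity) hd.le hB x) hm h1c,
        ← ENNReal.ofReal_mul (mul_pos (by positivity) (studentMass_pos hm)).le,
        show n + 1 + ν - 1 = n + ν by ring]
      congr 1
      ring
    simp_rw [inner]
    rw [lintegral_const_mul' _ _ ENNReal.ofReal_ne_top, ih (by positivity) hd,
      ← ENNReal.ofReal_mul (mul_pos (by positivity) (studentMass_pos hm)).le, hprod,
      mul_rpow h1c.le (by linarith), Finset.prod_range_succ]
    congr 1
    ring

lemma multiGamma_pos {m : ℕ} {z : ℝ} (hz : ((m : ℝ) - 1) / 2 < z) : 0 < multiGamma m z := by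
  refine mul_pos (by positivity) (Finset.prod_pos fun j _ => Gamma_pos_of_pos ?_)
  have : ((j : ℕ) : ℝ) + 1 ≤ m := by exact_mod_cast j.2
  linarith

lemma multiGamma_add_half (m : ℕ) (z : ℝ) :
    multiGamma m (z + 1 / 2) * Gamma (z + 1 / 2 - m / 2) = multiGamma m z * Gamma (z + 1 / 2) := by
  have h : (∏ j ∈ Finset.range m, Gamma (z + 1 / 2 - (j : ℝ) / 2)) * Gamma (z + 1 / 2 - m / 2) =
      (∏ j ∈ Finset.range m, Gamma (z - (j : ℝ) / 2)) * Gamma (z + 1 / 2) := by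
    rw [← Finset.prod_range_succ (fun j : ℕ => Gamma (z + 1 / 2 - (j : ℝ) / 2)),
      Finset.prod_range_succ']
    congr 1
    · refine Finset.prod_congr rfl fun j _ => ?_
      push_cast
      ring_nf
    · simp
  unfold multiGamma
  rw [Fin.prod_univ_eq_prod_range (fun j : ℕ => Gamma (z + 1 / 2 - (j : ℝ) / 2)),
    Fin.prod_univ_eq_prod_range (fun j : ℕ => Gamma (z - (j : ℝ) / 2)), mul_assoc, h, mul_assoc]

lemma prod_studentMass {m : ℕ} (n : ℕ) {ν : ℝ} (hm : 1 ≤ m) (hν : (m : ℝ) - 1 < ν) :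
    ∏ k ∈ Finset.range n, studentMass m (k + 1 + ν) =
      π ^ ((m : ℝ) * n / 2) * (multiGamma m (ν / 2) / multiGamma m ((n + ν) / 2)) := by
  have hm' : (1 : ℝ) ≤ m := by exact_mod_cast hm
  induction n with
  | zero =>
    have := multiGamma_pos (m := m) (z := ν / 2) (by linarith)
    simp [this.ne']
  | succ n ih =>
    have hn : (0 : ℝ) ≤ n := n.cast_nonneg
    have h0 := multiGamma_pos (m := m) (z := (n + ν) / 2) (by linarith)
    have h1 := multiGamma_pos (m := m) (z := (n + ν) / 2 + 1 / 2) (by linarith)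
    have hG : 0 < Gamma ((n + ν) / 2 + 1 / 2) := Gamma_pos_of_pos (by linarith)
    have h := multiGamma_add_half m ((n + ν) / 2)
    rw [Finset.prod_range_succ, ih, studentMass]
    push_cast
    rw [show ((n : ℝ) + 1 + ν) / 2 = (n + ν) / 2 + 1 / 2 by ring,
      show ((n : ℝ) + 1 + ν - m) / 2 = (n + ν) / 2 + 1 / 2 - m / 2 by ring,
      show (m : ℝ) * (n + 1) / 2 = m * n / 2 + m / 2 by ring, rpow_add pi_pos]
    generalize multiGamma m ((n + ν) / 2 + 1 / 2) = a at *
    generalize multiGamma m ((n + ν) / 2) = b at *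
    generalize Gamma ((n + ν) / 2 + 1 / 2 - m / 2) = d at *
    generalize Gamma ((n + ν) / 2 + 1 / 2) = e at *
    field_simp
    linear_combination multiGamma m (ν / 2) * h

lemma Matrix.PosDef.det_le_exp_trace_sub {m : ℕ} {H : Matrix (Fin m) (Fin m) ℝ}
    (hH : H.PosDef) : H.det ≤ exp (H.trace - m) := by
  have h1 : H.trace - m = ∑ i, (hH.1.eigenvalues i - 1) := by
    rw [hH.1.trace_eq_sum_eigenvalues]
    simp
  rw [hH.1.det_eq_prod_eigenvalues, h1, exp_sum]
  refine Finset.prod_le_prod (fun i _ => (hH.eigenvalues_pos i).le) fun i _ => ?_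
  simpa using add_one_le_exp (hH.1.eigenvalues i - 1)

lemma det_rpow_mul_exp_trace_le {m : ℕ} {S A : Matrix (Fin m) (Fin m) ℝ} (hS : S.PosDef)
    (hA : A.PosDef) {N : ℝ} (hN : 0 < N) :
    S.det ^ (-N / 2) * exp (-(1 / 2) * (S⁻¹ * A).trace) ≤
      (N⁻¹ • A).det ^ (-N / 2) * exp (-(m * N) / 2) := by
  obtain ⟨P, hP⟩ := hS.inv.exists_transpose_mul_self
  have hA' : (N⁻¹ • A).PosDef := hA.smul (inv_pos.mpr hN)
  have hdet : P.det * P.det = S.det⁻¹ := by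
    rw [← Ring.inverse_eq_inv', ← det_nonsing_inv, hP, det_mul, det_transpose]
  have hP0 : P.det ≠ 0 := fun h => by
    rw [h] at hdet
    exact (inv_pos.mpr hS.det_pos).ne (by simpa using hdet)
  have hH : (P * (N⁻¹ • A) * Pᵀ).PosDef := by
    have := hA'.mul_mul_conjTranspose_same (B := P)
      (vecMul_injective_of_isUnit ((isUnit_iff_isUnit_det P).mpr hP0.isUnit))
    rwa [conjTranspose_eq_transpose_of_trivial] at this
  have hHdet : (P * (N⁻¹ • A) * Pᵀ).det = S.det⁻¹ * (N⁻¹ • A).det := by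
    rw [det_mul, det_mul, det_transpose, ← hdet]
    ring
  have hHtr : (P * (N⁻¹ • A) * Pᵀ).trace = N⁻¹ * (S⁻¹ * A).trace := by
    rw [trace_mul_comm, ← mul_assoc, ← hP, Matrix.mul_smul, trace_smul, smul_eq_mul]
  have key := rpow_le_rpow hH.det_pos.le hH.det_le_exp_trace_sub (z := N / 2) (by positivity)
  rw [hHdet, hHtr, mul_rpow (inv_pos.mpr hS.det_pos).le hA'.det_pos.le, ← exp_mul,
    inv_rpow hS.det_pos.le, ← rpow_neg hS.det_pos.le, ← neg_div] at key
  have hAp : 0 < (N⁻¹ • A).det ^ (N / 2) := rpow_pos_of_pos hA'.det_pos _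
  rw [← le_div_iff₀ hAp] at key
  calc S.det ^ (-N / 2) * exp (-(1 / 2) * (S⁻¹ * A).trace)
      ≤ exp ((N⁻¹ * (S⁻¹ * A).trace - m) * (N / 2)) / (N⁻¹ • A).det ^ (N / 2) *
          exp (-(1 / 2) * (S⁻¹ * A).trace) := by gcongr
    _ = (N⁻¹ • A).det ^ (-N / 2) *
          (exp ((N⁻¹ * (S⁻¹ * A).trace - m) * (N / 2)) *
            exp (-(1 / 2) * (S⁻¹ * A).trace)) := by
        rw [neg_div, rpow_neg hA'.det_pos.le]
        ring
    _ = _ := by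
        rw [← exp_add]
        congr 2
        field_simp
        ring

lemma dotProduct_mulVec_self_eq_trace {m : ℕ} (M : Matrix (Fin m) (Fin m) ℝ) (a : Fin m → ℝ) :
    a ⬝ᵥ (M *ᵥ a) = (M * vecMulVec a a).trace := by
  rw [mul_vecMulVec, trace_vecMulVec, dotProduct_comm]

lemma sum_vecMulVec_sub_add_eq_scatter {m n : ℕ} {ν σ2 ρ2 : ℝ} (h : (n : ℝ) + ρ2 * ν ≠ 0)
    (x : Fin n → Fin m → ℝ) (μ : Fin m → ℝ) :
    ∑ i, vecMulVec (x i - μ) (x i - μ) +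
        ν • (σ2 • (1 : Matrix (Fin m) (Fin m) ℝ) + ρ2 • vecMulVec μ μ) =
      scatter (n + ρ2 * ν)⁻¹ ((ν * σ2) • 1) x +
        (n + ρ2 * ν) • vecMulVec (μ - muBar m n ν ρ2 x) (μ - muBar m n ν ρ2 x) := by
  have hs : ∑ i, vecMulVec (x i - μ) (x i - μ) = ∑ i, vecMulVec (x i) (x i) -
      vecMulVec (∑ i, x i) μ - vecMulVec μ (∑ i, x i) + (n : ℝ) • vecMulVec μ μ := by
    ext a b
    simp only [Matrix.sum_apply, vecMulVec_apply, Finset.sum_apply, Pi.sub_apply, sub_mul, mul_sub,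
      Finset.sum_sub_distrib, ← Finset.sum_mul, ← Finset.mul_sum, Matrix.add_apply,
      Matrix.sub_apply, Matrix.smul_apply, smul_eq_mul, Finset.sum_const, Finset.card_univ,
      Fintype.card_fin, nsmul_eq_mul]
    ring
  rw [hs, scatter, muBar]
  generalize ∑ i, x i = s
  obtain ⟨k, hk⟩ : ∃ k, k = (n : ℝ) + ρ2 * ν := ⟨_, rfl⟩
  rw [← hk] at h ⊢
  rw [show (n : ℝ) = k - ρ2 * ν by rw [hk]; ring]
  ext a b
  simp only [Matrix.add_apply, Matrix.sub_apply, Matrix.smul_apply, vecMulVec_apply, Pi.sub_apply,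
    Pi.smul_apply, smul_eq_mul]
  field_simp
  ring

lemma mvnLik_mul_luck {m n : ℕ} {ν σ2 ρ2 : ℝ} (h : (n : ℝ) + ρ2 * ν ≠ 0)
    (x : Fin n → Fin m → ℝ) (μ : Fin m → ℝ) {S : Matrix (Fin m) (Fin m) ℝ} (hS : S.PosDef) :
    mvnLik m n x μ S * luck m μ S ν σ2 ρ2 =
      (2 * π) ^ (-(m * (n + ν)) / 2) * (S.det ^ (-(n + ν) / 2) *
        exp (-(1 / 2) * ((S⁻¹ * scatter (n + ρ2 * ν)⁻¹ ((ν * σ2) • 1) x).trace +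
          (n + ρ2 * ν) * ((μ - muBar m n ν ρ2 x) ⬝ᵥ (S⁻¹ *ᵥ (μ - muBar m n ν ρ2 x)))))) := by
  have hd := hS.det_pos
  have h2 : ((2 * π) ^ (-(m : ℝ) / 2)) ^ n * (2 * π) ^ (-(m : ℝ) * ν / 2) =
      (2 * π) ^ (-(m * (n + ν)) / 2) := by
    rw [← rpow_natCast, ← rpow_mul (by positivity), ← rpow_add (by positivity)]
    congr 1
    ring
  have h3 : (S.det ^ (-(1 : ℝ) / 2)) ^ n * S.det ^ (-ν / 2) = S.det ^ (-(n + ν) / 2) := by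
    rw [← rpow_natCast, ← rpow_mul hd.le, ← rpow_add hd]
    congr 1
    ring
  have h4 : -(1 / 2) * ∑ i, ((x i - μ) ⬝ᵥ (S⁻¹ *ᵥ (x i - μ))) + -(ν / 2) *
        (S⁻¹ * (σ2 • (1 : Matrix (Fin m) (Fin m) ℝ) + ρ2 • vecMulVec μ μ)).trace =
      -(1 / 2) * ((S⁻¹ * scatter (n + ρ2 * ν)⁻¹ ((ν * σ2) • 1) x).trace +
          (n + ρ2 * ν) * ((μ - muBar m n ν ρ2 x) ⬝ᵥ (S⁻¹ *ᵥ (μ - muBar m n ν ρ2 x)))) := by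
    have := congrArg (fun T => (S⁻¹ * T).trace) (sum_vecMulVec_sub_add_eq_scatter (σ2 := σ2) h x μ)
    simp only [mul_add, trace_add, Finset.mul_sum, trace_sum, Matrix.mul_smul, trace_smul, smul_add,
      smul_eq_mul] at this ⊢
    simp_rw [dotProduct_mulVec_self_eq_trace]
    rw [← Finset.mul_sum]
    linear_combination -(1 / 2) * this
  rw [mvnLik, luck, Finset.prod_mul_distrib, Finset.prod_const, ← exp_sum, ← Finset.mul_sum,
    Finset.card_univ, Fintype.card_fin, mul_pow, ← h2, ← h3, ← h4, exp_add]
  ring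

lemma supLik_eq {m n : ℕ} {ν σ2 ρ2 : ℝ} (hν : 0 < ν) (hσ : 0 < σ2) (hρ : 0 < ρ2)
    (x : Fin n → Fin m → ℝ) :
    supLik m n ν σ2 ρ2 x = (2 * π) ^ (-(m * (n + ν)) / 2) *
      ((((n : ℝ) + ν)⁻¹ • scatter (n + ρ2 * ν)⁻¹ ((ν * σ2) • 1) x).det ^ (-(n + ν) / 2) *
        exp (-(m * (n + ν)) / 2)) := by
  have hn : (0 : ℝ) ≤ n := n.cast_nonneg
  have hN : 0 < (n : ℝ) + ν := by positivity
  have hk : 0 < (n : ℝ) + ρ2 * ν := by positivity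
  have hA : (scatter (n + ρ2 * ν)⁻¹ ((ν * σ2) • 1) x).PosDef := by
    refine scatter_posDef (by positivity) ?_ (PosDef.one.smul (by positivity)) x
    rw [inv_mul_le_iff₀ hk]
    nlinarith [mul_pos hρ hν]
  refine IsGreatest.csSup_eq ⟨⟨(muBar m n ν ρ2 x, ⟨_, hA.smul (inv_pos.mpr hN)⟩), ?_⟩, ?_⟩
  · have hinv : (((n : ℝ) + ν)⁻¹ • scatter (n + ρ2 * ν)⁻¹ ((ν * σ2) • 1) x)⁻¹ *
        scatter (n + ρ2 * ν)⁻¹ ((ν * σ2) • 1) x = ((n : ℝ) + ν) • 1 := by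
      have hs := (hA.smul (inv_pos.mpr hN)).det_pos.ne'.isUnit
      nth_rewrite 2 [← smul_inv_smul₀ hN.ne' (scatter (n + ρ2 * ν)⁻¹ ((ν * σ2) • 1) x)]
      rw [Matrix.mul_smul, nonsing_inv_mul _ hs]
    dsimp only
    rw [mvnLik_mul_luck hk.ne' x _ (hA.smul (inv_pos.mpr hN)), hinv]
    rw [sub_self, zero_dotProduct, trace_smul, trace_one, Fintype.card_fin, smul_eq_mul]
    ring_nf
  · rintro _ ⟨⟨μ, S, hS⟩, rfl⟩
    dsimp only
    rw [mvnLik_mul_luck hk.ne' x _ hS]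
    refine mul_le_mul_of_nonneg_left ?_ (by positivity)
    refine le_trans ?_ (det_rpow_mul_exp_trace_le hS hA hN)
    have hq := hS.inv.posSemidef.dotProduct_mulVec_nonneg (μ - muBar m n ν ρ2 x)
    rw [star_trivial] at hq
    have := mul_nonneg hk.le hq
    exact mul_le_mul_of_nonneg_left (exp_le_exp.mpr (by linarith)) (rpow_nonneg hS.det_pos.le _)

lemma capC_eq {m n : ℕ} {ν σ2 ρ2 : ℝ} (hν : 0 < ν) (hσ : 0 < σ2) (hρ : 0 < ρ2) :
    (2 * π) ^ (-(m * (n + ν)) / 2) *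
        (((((n : ℝ) + ν)⁻¹) ^ m) ^ (-(n + ν) / 2) * exp (-(m * (n + ν)) / 2)) *
      ((1 - (n + ρ2 * ν)⁻¹ * n) ^ (-(m : ℝ) / 2) * ((ν * σ2) ^ m) ^ (-ν / 2) *
        (π ^ ((m : ℝ) * n / 2) * (multiGamma m (ν / 2) / multiGamma m ((n + ν) / 2)))) =
      capC m n ν σ2 ρ2 := by
  have hn : (0 : ℝ) ≤ n := n.cast_nonneg
  have hN : 0 < (n : ℝ) + ν := by positivity
  have hk : 0 < (n : ℝ) + ρ2 * ν := by positivity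
  have hbase : ((n : ℝ) + ν) ^ ((n : ℝ) + ν) * (1 + n / (ρ2 * ν)) /
        ((2 * exp 1) ^ ((n : ℝ) + ν) * (π * ν) ^ ν) =
      (2 * π) ^ (-((n : ℝ) + ν)) * ((n : ℝ) + ν) ^ ((n : ℝ) + ν) * exp (-((n : ℝ) + ν)) *
        (1 + n / (ρ2 * ν)) * ν ^ (-ν) * π ^ (n : ℝ) := by
    have hπ : π ^ ((n : ℝ) + ν) = π ^ (n : ℝ) * π ^ ν := rpow_add pi_pos _ _
    rw [rpow_neg (by positivity), mul_rpow two_pos.le pi_pos.le, hπ, exp_neg,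
      mul_rpow two_pos.le (exp_pos _).le, exp_one_rpow, mul_rpow pi_pos.le hν.le, rpow_neg hν.le]
    field_simp
  have hc : 1 - ((n : ℝ) + ρ2 * ν)⁻¹ * n = (1 + n / (ρ2 * ν))⁻¹ := by
    field_simp
    ring
  have e1 : (2 * π) ^ (-(m * ((n : ℝ) + ν)) / 2) =
      ((2 * π) ^ (-((n : ℝ) + ν))) ^ ((m : ℝ) / 2) := by
    rw [← rpow_mul (by positivity)]
    ring_nf
  have e2 : ((((n : ℝ) + ν)⁻¹) ^ m) ^ (-((n : ℝ) + ν) / 2) =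
      (((n : ℝ) + ν) ^ ((n : ℝ) + ν)) ^ ((m : ℝ) / 2) := by
    rw [← rpow_natCast, ← rpow_neg_one, ← rpow_mul hN.le, ← rpow_mul hN.le, ← rpow_mul hN.le]
    ring_nf
  have e3 : exp (-(m * ((n : ℝ) + ν)) / 2) = (exp (-((n : ℝ) + ν))) ^ ((m : ℝ) / 2) := by
    rw [← exp_mul]
    ring_nf
  have e4 : (1 + n / (ρ2 * ν))⁻¹ ^ (-(m : ℝ) / 2) = (1 + n / (ρ2 * ν)) ^ ((m : ℝ) / 2) := by
    rw [inv_rpow (by positivity), ← rpow_neg (by positivity)]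
    ring_nf
  have e5 : ((ν * σ2) ^ m) ^ (-ν / 2) = (ν ^ (-ν)) ^ ((m : ℝ) / 2) * σ2 ^ (-(m : ℝ) * ν / 2) := by
    rw [← rpow_natCast, ← rpow_mul (by positivity), mul_rpow hν.le hσ.le, ← rpow_mul hν.le]
    ring_nf
  have e6 : π ^ ((m : ℝ) * n / 2) = (π ^ (n : ℝ)) ^ ((m : ℝ) / 2) := by
    rw [← rpow_mul pi_pos.le]
    ring_nf
  have hsplit : ∀ {a b c d e f z : ℝ}, 0 < a → 0 < b → 0 < c → 0 < d → 0 < e → 0 < f →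
      (a * b * c * d * e * f) ^ z = a ^ z * b ^ z * c ^ z * d ^ z * e ^ z * f ^ z := by
    intro a b c d e f z ha hb hc hd he hf
    rw [mul_rpow (by positivity) hf.le, mul_rpow (by positivity) he.le,
      mul_rpow (by positivity) hd.le, mul_rpow (by positivity) hc.le, mul_rpow ha.le hb.le]
  rw [capC, hbase, hc, e1, e2, e3, e4, e5, e6, hsplit (by positivity) (by positivity)
    (by positivity) (by positivity) (by positivity) (by positivity)]
  ring

/-- Theorem 1, capacity: the capacity of the normal model with
simple luckiness equals `𝒞(m, n, ν, σ², ρ²)`. -/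
theorem lnml_capacity (m n : ℕ) (hm : 1 ≤ m) (hn : 1 ≤ n) (ν σ2 ρ2 : ℝ)
    (hν : (m : ℝ) - 1 < ν) (hσ : 0 < σ2) (hρ : 0 < ρ2) :
    ∫ x : Fin n → Fin m → ℝ, supLik m n ν σ2 ρ2 x = capC m n ν σ2 ρ2 := by
  have hm' : (1 : ℝ) ≤ m := by exact_mod_cast hm
  have hν0 : 0 < ν := by linarith
  have hk : 0 < (n : ℝ) + ρ2 * ν := by positivity
  have hB : ((ν * σ2) • (1 : Matrix (Fin m) (Fin m) ℝ)).PosDef := PosDef.one.smul (by positivity)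
  have hcn : ((n : ℝ) + ρ2 * ν)⁻¹ * n < 1 := by
    rw [inv_mul_lt_iff₀ hk]
    linarith [mul_pos hρ hν0]
  have hpos := scatter_posDef (n := n) (inv_pos.mpr hk).le hcn.le hB
  have hint : ∫ x : Fin n → Fin m → ℝ,
      (scatter (n + ρ2 * ν)⁻¹ ((ν * σ2) • 1) x).det ^ (-(n + ν) / 2) =
      (1 - (n + ρ2 * ν)⁻¹ * n) ^ (-(m : ℝ) / 2) * ((ν * σ2) ^ m) ^ (-ν / 2) *
        (π ^ ((m : ℝ) * n / 2) * (multiGamma m (ν / 2) / multiGamma m ((n + ν) / 2))) := by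
    rw [integral_eq_lintegral_of_nonneg_ae
        (ae_of_all _ fun x => rpow_nonneg (hpos x).det_pos.le _)
        ((continuous_scatter _ _).matrix_det.measurable.pow_const _).aestronglyMeasurable,
      lintegral_det_scatter (inv_pos.mpr hk).le hcn hν hB, prod_studentMass n hm hν, det_smul,
      det_one, mul_one, Fintype.card_fin, ENNReal.toReal_ofReal]
    have h1 := multiGamma_pos (m := m) (z := ν / 2) (by linarith)
    have h2 := multiGamma_pos (m := m) (z := (n + ν) / 2)
      (by linarith [(n.cast_nonneg : (0 : ℝ) ≤ n)])
    have h3 := sub_pos.mpr hcn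
    positivity
  rw [← capC_eq hν0 hσ hρ, ← hint, ← integral_const_mul]
  refine integral_congr_ae (ae_of_all _ fun x => ?_)
  dsimp only
  rw [supLik_eq hν0 hσ hρ, det_smul, Fintype.card_fin,
    mul_rpow (by positivity) (hpos x).det_pos.le]
  ring
end
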